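/- Let τ be in the Siegel upper half-space ℍ₂ and suppose the theta constants satisfy θ₁²θ₂² − θ₃²θ₄² ≠ 0, θ₁²θ₃² − θ₂²θ₄² ≠ 0, and θ₁²θ₄² − θ₂²θ₃² ≠ 0. Define α = (θ₁⁴ − θ₂⁴ − θ₃⁴ + θ₄⁴)/(θ₁²θ₄² − θ₂²θ₃²), β = (θ₁⁴ + θ₂⁴ − θ₃⁴ − θ₄⁴)/(θ₁²θ₂² − θ₃²θ₄²), γ = (θ₁⁴ − θ₂⁴ + θ₃⁴ − θ₄⁴)/(θ₁²θ₃² − θ₂²θ₄²), and δ = θ₁θ₂θ₃θ₄·∏_{ε,ε'∈{±1}}(θ₁² + εθ₂² + ε'θ₃² + εε'θ₄²)/((θ₁²θ₂² − θ₃²θ₄²)(θ₁²θ₃² − θ₂²θ₄²)(θ₁²θ₄² − θ₂²θ₃²)). Then for every z ∈ ℂ², setting P = θ₁(z)², Q = θ₂(z)², R = θ₃(z)², S = θ₄(z)², and Φ = P² + Q² + R² + S² − α(PS + QR) − β(PQ + RS) − γ(PR + QS), one has Φ² − 4δ²SPQR = 0. -/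

import Mathlib

open scoped BigOperators

/-- Genus-two theta function with characteristic vectors `a`, `b`. -/
noncomputable def thetaFn (a b : Fin 2 → ℝ) (z : Fin 2 → ℂ) (τ : Matrix (Fin 2) (Fin 2) ℂ) : ℂ :=
  ∑' u : Fin 2 → ℤ,
    Complex.exp ((Real.pi : ℂ) * Complex.I *
      ((∑ i, ∑ j, ((u i : ℂ) + (a i : ℂ)) * τ i j * ((u j : ℂ) + (a j : ℂ))) +
        2 * ∑ i, ((u i : ℂ) + (a i : ℂ)) * (z i + (b i : ℂ))))

/-- The sixteen theta characteristics `[(a₁,a₂);(b₁,b₂)]`, 0-indexed: entry `i` is θ_{i+1}. -/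
def thetaChars : Fin 16 → (ℝ × ℝ) × (ℝ × ℝ) :=
  ![((0,0),(0,0)), ((0,0),(1,1)), ((0,0),(1,0)), ((0,0),(0,1)),
    ((1,0),(0,0)), ((1,0),(0,1)), ((0,1),(0,0)), ((1,1),(0,0)),
    ((0,1),(1,0)), ((1,1),(1,1)), ((0,1),(0,1)), ((0,1),(1,1)),
    ((1,1),(0,1)), ((1,0),(1,0)), ((1,0),(1,1)), ((1,1),(1,0))]

/-- `th i z τ` is the theta function θ_{i+1}(z, τ). -/
noncomputable def th (i : Fin 16) (z : Fin 2 → ℂ) (τ : Matrix (Fin 2) (Fin 2) ℂ) : ℂ :=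
  thetaFn ![(thetaChars i).1.1 / 2, (thetaChars i).1.2 / 2]
          ![(thetaChars i).2.1 / 2, (thetaChars i).2.2 / 2] z τ

/-- Membership in the Siegel upper half-space ℍ₂. -/
def IsSiegel (τ : Matrix (Fin 2) (Fin 2) ℂ) : Prop :=
  τ 0 1 = τ 1 0 ∧ 0 < (τ 1 1).im ∧ (τ 0 1).im ^ 2 < (τ 0 0).im * (τ 1 1).im

/-- The general term of the genus two theta series (the shift `b` is merged into `w = z + b`). -/
noncomputable def gterm (p q r : ℂ) (a₁ a₂ : ℝ) (w₁ w₂ : ℂ) (u : ℤ × ℤ) : ℂ :=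
  Complex.exp ((Real.pi : ℂ) * Complex.I *
    (((u.1 : ℂ) + a₁)^2 * p + 2 * ((u.1 : ℂ) + a₁) * ((u.2 : ℂ) + a₂) * q + ((u.2 : ℂ) + a₂)^2 * r
      + 2 * (((u.1 : ℂ) + a₁) * w₁ + ((u.2 : ℂ) + a₂) * w₂)))

/-- Scalar form of the genus two theta function. -/
noncomputable def gth (p q r : ℂ) (a₁ a₂ : ℝ) (w₁ w₂ : ℂ) : ℂ := ∑' u, gterm p q r a₁ a₂ w₁ w₂ u

/-- Positivity of the imaginary part, in scalar form. -/
def SgPos (p q r : ℂ) : Prop := 0 < r.im ∧ q.im ^ 2 < p.im * r.im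

lemma SgPos.double {p q r : ℂ} (h : SgPos p q r) : SgPos (2*p) (2*q) (2*r) := by
  obtain ⟨h1, h2⟩ := h
  constructor
  · simpa using h1
  · simp; nlinarith

lemma summable_one (l : ℝ) (hl : 0 < l) (a y : ℝ) :
    Summable fun n : ℤ => Real.exp (-Real.pi * (l * ((n:ℝ)+a)^2 + 2*((n:ℝ)+a)*y)) := by
  have h := ((summable_jacobiTheta₂_term_iff (((l*a + y : ℝ) : ℂ) * Complex.I)
    ((l : ℂ) * Complex.I)).2 (by simpa using hl)).norm
  refine (h.mul_left (Real.exp (-Real.pi * (l*a^2 + 2*a*y)))).congr ?_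
  intro n
  rw [norm_jacobiTheta₂_term, ← Real.exp_add]
  congr 1
  simp
  ring

lemma gterm_summable {p q r : ℂ} (h : SgPos p q r) (a₁ a₂ : ℝ) (w₁ w₂ : ℂ) :
    Summable fun u => ‖gterm p q r a₁ a₂ w₁ w₂ u‖ := by
  obtain ⟨h1, h2⟩ := h
  have hp : 0 < p.im := by
    by_contra hh
    push Not at hh
    nlinarith [sq_nonneg q.im]
  have htr : 0 < p.im + r.im := by linarith
  set l : ℝ := (p.im * r.im - q.im^2) / (p.im + r.im) with hl
  have hlpos : 0 < l := div_pos (by linarith) htr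
  have hs := (summable_one l hlpos a₁ w₁.im).mul_of_nonneg (summable_one l hlpos a₂ w₂.im)
    (fun _ => (Real.exp_pos _).le) (fun _ => (Real.exp_pos _).le)
  refine Summable.of_nonneg_of_le (fun _ => norm_nonneg _) ?_ hs
  rintro ⟨m, n⟩
  rw [gterm, Complex.norm_exp, ← Real.exp_add, Real.exp_le_exp]
  set x : ℝ := (m:ℝ) + a₁ with hx
  set y : ℝ := (n:ℝ) + a₂ with hy
  have hxc : ((m:ℂ) + a₁) = (x : ℂ) := by rw [hx]; push_cast; ring
  have hyc : ((n:ℂ) + a₂) = (y : ℂ) := by rw [hy]; push_cast; ring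
  have hre : ((Real.pi : ℂ) * Complex.I * (((m:ℂ) + a₁)^2 * p + 2 * ((m:ℂ) + a₁) * ((n:ℂ) + a₂) * q
      + ((n:ℂ) + a₂)^2 * r + 2 * (((m:ℂ) + a₁) * w₁ + ((n:ℂ) + a₂) * w₂))).re
      = -Real.pi * (x^2*p.im + 2*x*y*q.im + y^2*r.im + 2*(x*w₁.im + y*w₂.im)) := by
    rw [hxc, hyc]
    simp [pow_two]
  have hq : l*x^2 + l*y^2 ≤ x^2*p.im + 2*x*y*q.im + y^2*r.im := by
    have : x^2*p.im + 2*x*y*q.im + y^2*r.im - (l*x^2 + l*y^2)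
      = ((p.im*x+q.im*y)^2 + (q.im*x+r.im*y)^2)/(p.im+r.im) := by
      rw [hl]; field_simp; ring
    have h0 : 0 ≤ ((p.im*x+q.im*y)^2 + (q.im*x+r.im*y)^2)/(p.im+r.im) := by positivity
    linarith
  show Complex.re (_ * _ * (((m:ℂ) + a₁)^2 * p + _ + _ + _)) ≤ _
  rw [hre]
  nlinarith [Real.pi_pos, mul_le_mul_of_nonneg_left hq Real.pi_pos.le]

/-- Coefficient of a bit. -/
def bt (s : Bool) : ℤ := if s then 1 else 0

lemma pairs_bij : Function.Bijective (fun x : (Bool × Bool) × ((ℤ × ℤ) × (ℤ × ℤ)) =>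
    (((x.2.1.1 + x.2.2.1 + bt x.1.1, x.2.1.2 + x.2.2.2 + bt x.1.2),
      (x.2.1.1 - x.2.2.1, x.2.1.2 - x.2.2.2)) : (ℤ × ℤ) × (ℤ × ℤ))) := by
  constructor
  · rintro ⟨⟨s, t⟩, ⟨m₁, m₂⟩, ⟨n₁, n₂⟩⟩ ⟨⟨s', t'⟩, ⟨m₁', m₂'⟩, ⟨n₁', n₂'⟩⟩ h
    simp only [Prod.mk.injEq] at h
    obtain ⟨⟨h1, h2⟩, h3, h4⟩ := h
    have hs : s = s' := by
      cases s <;> cases s' <;> simp [bt] at h1 ⊢ <;> omega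
    have ht : t = t' := by
      cases t <;> cases t' <;> simp [bt] at h2 ⊢ <;> omega
    subst hs ht
    simp only [Prod.mk.injEq, true_and]
    refine ⟨⟨?_, ?_⟩, ?_, ?_⟩ <;> omega
  · rintro ⟨⟨u₁, u₂⟩, ⟨v₁, v₂⟩⟩
    have key : ∀ u v : ℤ, ∃ s : Bool, ∃ m n : ℤ, m + n + bt s = u ∧ m - n = v := by
      intro u v
      rcases Int.emod_two_eq_zero_or_one (u + v) with h | h
      · exact ⟨false, (u+v)/2, (u-v)/2, by simp [bt]; omega, by omega⟩
      · exact ⟨true, (u+v)/2, (u-v)/2, by simp [bt]; omega, by omega⟩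
    obtain ⟨s, m, n, e1, e2⟩ := key u₁ v₁
    obtain ⟨t, m', n', e3, e4⟩ := key u₂ v₂
    exact ⟨⟨⟨s, t⟩, ⟨m, m'⟩, ⟨n, n'⟩⟩, by simp [e1, e2, e3, e4]⟩

/-- The addition formula. -/
lemma gth_add {p q r : ℂ} (h : SgPos p q r) (a₁ a₂ a₁' a₂' : ℝ) (w₁ w₂ w₁' w₂' : ℂ) :
    gth p q r a₁ a₂ w₁ w₂ * gth p q r a₁' a₂' w₁' w₂' =
      ∑ s : Bool × Bool,
        gth (2*p) (2*q) (2*r) ((bt s.1 + a₁ + a₁')/2) ((bt s.2 + a₂ + a₂')/2) (w₁ + w₁') (w₂ + w₂')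
        * gth (2*p) (2*q) (2*r) ((bt s.1 + a₁ - a₁')/2) ((bt s.2 + a₂ - a₂')/2)
          (w₁ - w₁') (w₂ - w₂') := by
  have s1 := gterm_summable h a₁ a₂ w₁ w₂
  have s2 := gterm_summable h a₁' a₂' w₁' w₂'
  unfold gth
  rw [tsum_mul_tsum_of_summable_norm s1 s2]
  have hs := summable_mul_of_summable_norm s1 s2
  let e := Equiv.ofBijective _ pairs_bij
  rw [← e.tsum_eq]
  have hs' := (e.summable_iff).2 hs
  simp only [Function.comp_def] at hs'
  rw [Summable.tsum_prod hs', tsum_fintype]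
  refine Finset.sum_congr rfl ?_
  rintro ⟨s, t⟩ -
  rw [tsum_mul_tsum_of_summable_norm (gterm_summable h.double _ _ _ _)
    (gterm_summable h.double _ _ _ _)]
  refine tsum_congr ?_
  rintro ⟨⟨m₁, m₂⟩, ⟨n₁, n₂⟩⟩
  simp only [e, Equiv.ofBijective_apply, gterm]
  rw [← Complex.exp_add, ← Complex.exp_add]
  congr 1
  push_cast
  ring

lemma gth_shift₁ (p q r : ℂ) (a₁ a₂ : ℝ) (w₁ w₂ : ℂ) :
    gth p q r (a₁ + 1) a₂ w₁ w₂ = gth p q r a₁ a₂ w₁ w₂ := by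
  unfold gth
  rw [← ((Equiv.addRight (1:ℤ)).prodCongr (Equiv.refl ℤ)).tsum_eq (gterm p q r a₁ a₂ w₁ w₂)]
  refine tsum_congr ?_
  rintro ⟨m, n⟩
  simp only [gterm, Equiv.prodCongr_apply, Prod.map, Equiv.coe_addRight, Equiv.refl_apply]
  congr 1
  push_cast
  ring

lemma gth_shift₂ (p q r : ℂ) (a₁ a₂ : ℝ) (w₁ w₂ : ℂ) :
    gth p q r a₁ (a₂ + 1) w₁ w₂ = gth p q r a₁ a₂ w₁ w₂ := by
  unfold gth
  rw [← ((Equiv.refl ℤ).prodCongr (Equiv.addRight (1:ℤ))).tsum_eq (gterm p q r a₁ a₂ w₁ w₂)]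
  refine tsum_congr ?_
  rintro ⟨m, n⟩
  simp only [gterm, Equiv.prodCongr_apply, Prod.map, Equiv.coe_addRight, Equiv.refl_apply]
  congr 1
  push_cast
  ring

lemma gth_per₁ (p q r : ℂ) (a₁ a₂ : ℝ) (w₁ w₂ : ℂ) :
    gth p q r a₁ a₂ (w₁ + 1) w₂ = Complex.exp (2 * Real.pi * Complex.I * a₁)
      * gth p q r a₁ a₂ w₁ w₂ := by
  unfold gth
  rw [← tsum_mul_left]
  refine tsum_congr ?_
  rintro ⟨m, n⟩
  simp only [gterm]
  rw [← Complex.exp_add, Complex.exp_eq_exp_iff_exists_int]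
  exact ⟨m, by ring⟩

lemma gth_per₂ (p q r : ℂ) (a₁ a₂ : ℝ) (w₁ w₂ : ℂ) :
    gth p q r a₁ a₂ w₁ (w₂ + 1) = Complex.exp (2 * Real.pi * Complex.I * a₂)
      * gth p q r a₁ a₂ w₁ w₂ := by
  unfold gth
  rw [← tsum_mul_left]
  refine tsum_congr ?_
  rintro ⟨m, n⟩
  simp only [gterm]
  rw [← Complex.exp_add, Complex.exp_eq_exp_iff_exists_int]
  exact ⟨n, by ring⟩

lemma gth_neg (p q r : ℂ) (a₁ a₂ : ℝ) (w₁ w₂ : ℂ) :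
    gth p q r (-a₁) (-a₂) (-w₁) (-w₂) = gth p q r a₁ a₂ w₁ w₂ := by
  unfold gth
  rw [← ((Equiv.neg ℤ).prodCongr (Equiv.neg ℤ)).tsum_eq (gterm p q r a₁ a₂ w₁ w₂)]
  refine tsum_congr ?_
  rintro ⟨m, n⟩
  simp only [gterm, Equiv.prodCongr_apply, Prod.map, Equiv.neg_apply]
  congr 1
  push_cast
  ring

lemma thetaFn_eq (a b z : Fin 2 → _) (τ : Matrix (Fin 2) (Fin 2) ℂ) (h : τ 0 1 = τ 1 0) :
    thetaFn a b z τ = gth (τ 0 0) (τ 0 1) (τ 1 1) (a 0) (a 1) (z 0 + b 0) (z 1 + b 1) := by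
  unfold thetaFn gth
  rw [← (finTwoArrowEquiv ℤ).tsum_eq]
  refine tsum_congr ?_
  intro u
  have hu : finTwoArrowEquiv ℤ u = (u 0, u 1) := rfl
  simp only [gterm, hu, Fin.sum_univ_two]
  congr 1
  rw [← h]
  ring

lemma gth_shift_half₁ (p q r : ℂ) (a₂ : ℝ) (w₁ w₂ : ℂ) :
    gth p q r (1/2 + 1/2) a₂ w₁ w₂ = gth p q r 0 a₂ w₁ w₂ := by
  rw [← gth_shift₁ p q r 0]; norm_num

lemma gth_shift_half₂ (p q r : ℂ) (a₁ : ℝ) (w₁ w₂ : ℂ) :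
    gth p q r a₁ (1/2 + 1/2) w₁ w₂ = gth p q r a₁ 0 w₁ w₂ := by
  rw [← gth_shift₂ p q r a₁ 0]; norm_num

lemma exp_half : Complex.exp (2 * Real.pi * Complex.I * ((1/2 : ℝ) : ℂ)) = -1 := by
  rw [← Complex.exp_pi_mul_I]; congr 1; push_cast; ring

lemma gth_per₁_zero (p q r : ℂ) (a₂ : ℝ) (w₁ w₂ : ℂ) :
    gth p q r 0 a₂ (w₁ + 1) w₂ = gth p q r 0 a₂ w₁ w₂ := by
  rw [gth_per₁]; simp

lemma gth_per₁_half (p q r : ℂ) (a₂ : ℝ) (w₁ w₂ : ℂ) :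
    gth p q r (1/2) a₂ (w₁ + 1) w₂ = - gth p q r (1/2) a₂ w₁ w₂ := by
  rw [gth_per₁, exp_half]; ring

lemma gth_per₂_zero (p q r : ℂ) (a₁ : ℝ) (w₁ w₂ : ℂ) :
    gth p q r a₁ 0 w₁ (w₂ + 1) = gth p q r a₁ 0 w₁ w₂ := by
  rw [gth_per₂]; simp

lemma gth_per₂_half (p q r : ℂ) (a₁ : ℝ) (w₁ w₂ : ℂ) :
    gth p q r a₁ (1/2) w₁ (w₂ + 1) = - gth p q r a₁ (1/2) w₁ w₂ := by
  rw [gth_per₂, exp_half]; ring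

lemma gth_half_flip (p q r : ℂ) (a₂ : ℝ) :
    gth p q r 0 a₂ (-(1/2)) 0 = gth p q r 0 a₂ (1/2) 0 := by
  rw [← gth_per₁_zero]; norm_num

lemma gth_odd₀ (p q r : ℂ) : gth p q r (1/2) 0 (1/2) 0 = 0 := by
  have h1 := gth_neg p q r (1/2) 0 (1/2) 0
  have h2 := gth_shift₁ p q r (-(1/2)) 0 (-(1/2)) 0
  have h3 := gth_per₁_half p q r 0 (-(1/2)) 0
  norm_num at h1 h2 h3 ⊢
  linear_combination (1/2)*h3 + (1/2)*(- h1 - h2)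

lemma gth_odd₁ (p q r : ℂ) : gth p q r (1/2) (1/2) (1/2) 0 = 0 := by
  have h1 := gth_neg p q r (1/2) (1/2) (1/2) 0
  have h2 := gth_shift₁ p q r (-(1/2)) (-(1/2)) (-(1/2)) 0
  have h2' := gth_shift₂ p q r (1/2) (-(1/2)) (-(1/2)) 0
  have h3 := gth_per₁_half p q r (1/2) (-(1/2)) 0
  norm_num at h1 h2 h2' h3 ⊢
  linear_combination (1/2)*h3 + (1/2)*(- h1 - h2 - h2')

lemma gth_oddn₀ (p q r : ℂ) : gth p q r (1/2) 0 (-(1/2)) 0 = 0 := by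
  have h3 := gth_per₁_half p q r 0 (-(1/2)) 0
  have h := gth_odd₀ p q r
  norm_num at h3 h ⊢
  linear_combination h3 - h

lemma gth_oddn₁ (p q r : ℂ) : gth p q r (1/2) (1/2) (-(1/2)) 0 = 0 := by
  have h3 := gth_per₁_half p q r (1/2) (-(1/2)) 0
  have h := gth_odd₁ p q r
  norm_num at h3 h ⊢
  linear_combination h3 - h

lemma gth_mul {p q r : ℂ} (h : SgPos p q r) (w₁ w₂ w₁' w₂' : ℂ) :
    gth p q r 0 0 w₁ w₂ * gth p q r 0 0 w₁' w₂' =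
      gth (2*p) (2*q) (2*r) 0 0 (w₁ + w₁') (w₂ + w₂') *
        gth (2*p) (2*q) (2*r) 0 0 (w₁ - w₁') (w₂ - w₂')
      + gth (2*p) (2*q) (2*r) (1/2) 0 (w₁ + w₁') (w₂ + w₂') *
        gth (2*p) (2*q) (2*r) (1/2) 0 (w₁ - w₁') (w₂ - w₂')
      + gth (2*p) (2*q) (2*r) 0 (1/2) (w₁ + w₁') (w₂ + w₂') *
        gth (2*p) (2*q) (2*r) 0 (1/2) (w₁ - w₁') (w₂ - w₂')
      + gth (2*p) (2*q) (2*r) (1/2) (1/2) (w₁ + w₁') (w₂ + w₂') *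
        gth (2*p) (2*q) (2*r) (1/2) (1/2) (w₁ - w₁') (w₂ - w₂') := by
  rw [gth_add h, Fintype.sum_prod_type]
  simp only [Fintype.sum_bool, bt]
  norm_num
  ring

lemma gth_sq {p q r : ℂ} (h : SgPos p q r) (a₁ a₂ : ℝ) (w₁ w₂ : ℂ) :
    gth p q r a₁ a₂ w₁ w₂ ^ 2 =
      gth (2*p) (2*q) (2*r) a₁ a₂ (2*w₁) (2*w₂) * gth (2*p) (2*q) (2*r) 0 0 0 0
      + gth (2*p) (2*q) (2*r) (1/2 + a₁) a₂ (2*w₁) (2*w₂) * gth (2*p) (2*q) (2*r) (1/2) 0 0 0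
      + gth (2*p) (2*q) (2*r) a₁ (1/2 + a₂) (2*w₁) (2*w₂) * gth (2*p) (2*q) (2*r) 0 (1/2) 0 0
      + gth (2*p) (2*q) (2*r) (1/2 + a₁) (1/2 + a₂) (2*w₁) (2*w₂)
        * gth (2*p) (2*q) (2*r) (1/2) (1/2) 0 0 := by
  have e0 : ∀ a : ℝ, (((0:ℤ):ℝ) + a + a)/2 = a := fun a => by push_cast; ring
  have e1 : ∀ a : ℝ, (((1:ℤ):ℝ) + a + a)/2 = 1/2 + a := fun a => by push_cast; ring
  have f0 : ∀ a : ℝ, (((0:ℤ):ℝ) + a - a)/2 = 0 := fun a => by push_cast; ring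
  have f1 : ∀ a : ℝ, (((1:ℤ):ℝ) + a - a)/2 = 1/2 := fun a => by push_cast; ring
  rw [pow_two, gth_add h, Fintype.sum_prod_type]
  simp only [Fintype.sum_bool, bt, if_true, Bool.false_eq_true, if_false, e0, e1, f0, f1, sub_self,
    ← two_mul]
  ring

section level

variable {p q r : ℂ} (h : SgPos p q r) (z₁ z₂ : ℂ)
include h

lemma lev_sq₁ : gth p q r 0 0 z₁ z₂ ^ 2 =
    gth (2*p) (2*q) (2*r) 0 0 (2*z₁) (2*z₂) * gth (2*p) (2*q) (2*r) 0 0 0 0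
    + gth (2*p) (2*q) (2*r) (1/2) 0 (2*z₁) (2*z₂) * gth (2*p) (2*q) (2*r) (1/2) 0 0 0
    + gth (2*p) (2*q) (2*r) 0 (1/2) (2*z₁) (2*z₂) * gth (2*p) (2*q) (2*r) 0 (1/2) 0 0
    + gth (2*p) (2*q) (2*r) (1/2) (1/2) (2*z₁) (2*z₂) * gth (2*p) (2*q) (2*r) (1/2) (1/2) 0 0 := by
  rw [gth_sq h, add_zero]

lemma lev_sq₂ : gth p q r 0 0 (z₁ + 1/2) (z₂ + 1/2) ^ 2 =
    gth (2*p) (2*q) (2*r) 0 0 (2*z₁) (2*z₂) * gth (2*p) (2*q) (2*r) 0 0 0 0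
    - gth (2*p) (2*q) (2*r) (1/2) 0 (2*z₁) (2*z₂) * gth (2*p) (2*q) (2*r) (1/2) 0 0 0
    - gth (2*p) (2*q) (2*r) 0 (1/2) (2*z₁) (2*z₂) * gth (2*p) (2*q) (2*r) 0 (1/2) 0 0
    + gth (2*p) (2*q) (2*r) (1/2) (1/2) (2*z₁) (2*z₂) * gth (2*p) (2*q) (2*r) (1/2) (1/2) 0 0 := by
  have e : ∀ z : ℂ, 2*(z+1/2) = 2*z+1 := fun z => by ring
  simp only [gth_sq h, add_zero, e, gth_per₁_zero, gth_per₁_half, gth_per₂_zero, gth_per₂_half]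
  ring

lemma lev_sq₃ : gth p q r 0 0 (z₁ + 1/2) z₂ ^ 2 =
    gth (2*p) (2*q) (2*r) 0 0 (2*z₁) (2*z₂) * gth (2*p) (2*q) (2*r) 0 0 0 0
    - gth (2*p) (2*q) (2*r) (1/2) 0 (2*z₁) (2*z₂) * gth (2*p) (2*q) (2*r) (1/2) 0 0 0
    + gth (2*p) (2*q) (2*r) 0 (1/2) (2*z₁) (2*z₂) * gth (2*p) (2*q) (2*r) 0 (1/2) 0 0
    - gth (2*p) (2*q) (2*r) (1/2) (1/2) (2*z₁) (2*z₂) * gth (2*p) (2*q) (2*r) (1/2) (1/2) 0 0 := by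
  have e : ∀ z : ℂ, 2*(z+1/2) = 2*z+1 := fun z => by ring
  simp only [gth_sq h, add_zero, e, gth_per₁_zero, gth_per₁_half, gth_per₂_zero, gth_per₂_half]
  ring

lemma lev_sq₄ : gth p q r 0 0 z₁ (z₂ + 1/2) ^ 2 =
    gth (2*p) (2*q) (2*r) 0 0 (2*z₁) (2*z₂) * gth (2*p) (2*q) (2*r) 0 0 0 0
    + gth (2*p) (2*q) (2*r) (1/2) 0 (2*z₁) (2*z₂) * gth (2*p) (2*q) (2*r) (1/2) 0 0 0
    - gth (2*p) (2*q) (2*r) 0 (1/2) (2*z₁) (2*z₂) * gth (2*p) (2*q) (2*r) 0 (1/2) 0 0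
    - gth (2*p) (2*q) (2*r) (1/2) (1/2) (2*z₁) (2*z₂) * gth (2*p) (2*q) (2*r) (1/2) (1/2) 0 0 := by
  have e : ∀ z : ℂ, 2*(z+1/2) = 2*z+1 := fun z => by ring
  simp only [gth_sq h, add_zero, e, gth_per₁_zero, gth_per₁_half, gth_per₂_zero, gth_per₂_half]
  ring

lemma lev_sq_a₁ : gth p q r (1/2) 0 z₁ z₂ ^ 2 =
    gth (2*p) (2*q) (2*r) (1/2) 0 (2*z₁) (2*z₂) * gth (2*p) (2*q) (2*r) 0 0 0 0
    + gth (2*p) (2*q) (2*r) 0 0 (2*z₁) (2*z₂) * gth (2*p) (2*q) (2*r) (1/2) 0 0 0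
    + gth (2*p) (2*q) (2*r) (1/2) (1/2) (2*z₁) (2*z₂) * gth (2*p) (2*q) (2*r) 0 (1/2) 0 0
    + gth (2*p) (2*q) (2*r) 0 (1/2) (2*z₁) (2*z₂) * gth (2*p) (2*q) (2*r) (1/2) (1/2) 0 0 := by
  simp only [gth_sq h, add_zero, gth_shift_half₁, gth_shift_half₂]

lemma lev_sq_a₂ : gth p q r 0 (1/2) z₁ z₂ ^ 2 =
    gth (2*p) (2*q) (2*r) 0 (1/2) (2*z₁) (2*z₂) * gth (2*p) (2*q) (2*r) 0 0 0 0
    + gth (2*p) (2*q) (2*r) (1/2) (1/2) (2*z₁) (2*z₂) * gth (2*p) (2*q) (2*r) (1/2) 0 0 0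
    + gth (2*p) (2*q) (2*r) 0 0 (2*z₁) (2*z₂) * gth (2*p) (2*q) (2*r) 0 (1/2) 0 0
    + gth (2*p) (2*q) (2*r) (1/2) 0 (2*z₁) (2*z₂) * gth (2*p) (2*q) (2*r) (1/2) (1/2) 0 0 := by
  simp only [gth_sq h, add_zero, gth_shift_half₁, gth_shift_half₂]

lemma lev_sq_a₃ : gth p q r (1/2) (1/2) z₁ z₂ ^ 2 =
    gth (2*p) (2*q) (2*r) (1/2) (1/2) (2*z₁) (2*z₂) * gth (2*p) (2*q) (2*r) 0 0 0 0
    + gth (2*p) (2*q) (2*r) 0 (1/2) (2*z₁) (2*z₂) * gth (2*p) (2*q) (2*r) (1/2) 0 0 0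
    + gth (2*p) (2*q) (2*r) (1/2) 0 (2*z₁) (2*z₂) * gth (2*p) (2*q) (2*r) 0 (1/2) 0 0
    + gth (2*p) (2*q) (2*r) 0 0 (2*z₁) (2*z₂) * gth (2*p) (2*q) (2*r) (1/2) (1/2) 0 0 := by
  simp only [gth_sq h, add_zero, gth_shift_half₁, gth_shift_half₂]

lemma lev_sq_V₁ : gth p q r 0 (1/2) (z₁ + 1/2) z₂ ^ 2 =
    gth (2*p) (2*q) (2*r) 0 (1/2) (2*z₁) (2*z₂) * gth (2*p) (2*q) (2*r) 0 0 0 0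
    - gth (2*p) (2*q) (2*r) (1/2) (1/2) (2*z₁) (2*z₂) * gth (2*p) (2*q) (2*r) (1/2) 0 0 0
    + gth (2*p) (2*q) (2*r) 0 0 (2*z₁) (2*z₂) * gth (2*p) (2*q) (2*r) 0 (1/2) 0 0
    - gth (2*p) (2*q) (2*r) (1/2) 0 (2*z₁) (2*z₂) * gth (2*p) (2*q) (2*r) (1/2) (1/2) 0 0 := by
  have e : ∀ z : ℂ, 2*(z+1/2) = 2*z+1 := fun z => by ring
  simp only [gth_sq h, add_zero, gth_shift_half₁, gth_shift_half₂, e, gth_per₁_zero, gth_per₁_half]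
  ring

lemma lev_prod₁₃ : gth p q r 0 0 z₁ z₂ * gth p q r 0 0 (z₁ + 1/2) z₂ =
    gth (2*p) (2*q) (2*r) 0 0 (2*z₁ + 1/2) (2*z₂) * gth (2*p) (2*q) (2*r) 0 0 (1/2) 0
    + gth (2*p) (2*q) (2*r) 0 (1/2) (2*z₁ + 1/2) (2*z₂)
      * gth (2*p) (2*q) (2*r) 0 (1/2) (1/2) 0 := by
  have e1 : z₁ + (z₁ + 1/2) = 2*z₁ + 1/2 := by ring
  have e2 : z₁ - (z₁ + 1/2) = -(1/2) := by ring
  have e3 : z₂ + z₂ = 2*z₂ := by ring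
  rw [gth_mul h, e1, e2, e3, sub_self, gth_oddn₀, gth_oddn₁, gth_half_flip, gth_half_flip]
  ring

lemma lev_prod₂₄ : gth p q r 0 0 (z₁ + 1/2) (z₂ + 1/2) * gth p q r 0 0 z₁ (z₂ + 1/2) =
    gth (2*p) (2*q) (2*r) 0 0 (2*z₁ + 1/2) (2*z₂) * gth (2*p) (2*q) (2*r) 0 0 (1/2) 0
    - gth (2*p) (2*q) (2*r) 0 (1/2) (2*z₁ + 1/2) (2*z₂)
      * gth (2*p) (2*q) (2*r) 0 (1/2) (1/2) 0 := by
  have e1 : z₁ + 1/2 + z₁ = 2*z₁ + 1/2 := by ring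
  have e2 : z₁ + 1/2 - z₁ = 1/2 := by ring
  have e3 : z₂ + 1/2 + (z₂ + 1/2) = 2*z₂ + 1 := by ring
  rw [gth_mul h, e1, e2, e3, sub_self, gth_odd₀, gth_odd₁, gth_per₂_zero, gth_per₂_half]
  ring

end level

/-- The Riemann-type identity, after expanding everything at level `4τ`. -/
lemma alg_riemann (t0 t1 t2 t3 S0 S1 S2 S3 U0 U1 U2 U3 a0 a1 a2 a3 V0 V1 v0 v1 c W : ℂ)
    (hU0 : U0 = t0*S0+t1*S1+t2*S2+t3*S3) (hU1 : U1 = t0*S1+t1*S0+t2*S3+t3*S2)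
    (hU2 : U2 = t0*S2+t2*S0+t1*S3+t3*S1) (hU3 : U3 = t0*S3+t3*S0+t1*S2+t2*S1)
    (ha0 : a0 = t0*t0+t1*t1+t2*t2+t3*t3) (ha1 : a1 = t0*t1+t1*t0+t2*t3+t3*t2)
    (ha2 : a2 = t0*t2+t2*t0+t1*t3+t3*t1) (ha3 : a3 = t0*t3+t3*t0+t1*t2+t2*t1)
    (hV0 : V0 = t0*S0-t1*S1+t2*S2-t3*S3) (hV1 : V1 = t0*S2-t1*S3+t2*S0-t3*S1)
    (hv0 : v0 = t0*t0-t1*t1+t2*t2-t3*t3) (hv1 : v1 = t0*t2-t1*t3+t2*t0-t3*t1)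
    (hc : c = v0*v0-v1*v1) (hW : W = V0*v0-V1*v1) :
    4*(c*W) =
      (a0-a1-a2+a3)*(a0-a1+a2-a3)*(a0+a1-a2-a3)*(U0+U1+U2+U3)
      + (a0+a1+a2+a3)*(a0-a1+a2-a3)*(a0+a1-a2-a3)*(U0-U1-U2+U3)
      + (a0+a1+a2+a3)*(a0-a1-a2+a3)*(a0+a1-a2-a3)*(U0-U1+U2-U3)
      + (a0+a1+a2+a3)*(a0-a1-a2+a3)*(a0-a1+a2-a3)*(U0+U1-U2-U3) := by
  subst_vars; ring

lemma alg_final (A0 A1 A2 A3 X0 X1 X2 X3 a0 a1 a2 a3 U0 U1 U2 U3 p q r s P Q R S c W α β γ δ : ℂ)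
    (ha0 : a0 = A0^2) (ha1 : a1 = A1^2) (ha2 : a2 = A2^2) (ha3 : a3 = A3^2)
    (hU0 : U0 = X0^2) (hU1 : U1 = X1^2) (hU2 : U2 = X2^2) (hU3 : U3 = X3^2)
    (hp : p = a0+a1+a2+a3) (hq : q = a0-a1-a2+a3) (hr : r = a0-a1+a2-a3) (hs : s = a0+a1-a2-a3)
    (hP : P = X0*A0+X1*A1+X2*A2+X3*A3) (hQ : Q = X0*A0-X1*A1-X2*A2+X3*A3)
    (hR : R = X0*A0-X1*A1+X2*A2-X3*A3) (hS : S = X0*A0+X1*A1-X2*A2-X3*A3)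
    (hW2 : W^2 = P*Q*R*S)
    (hcW : 4*(c*W) = q*r*s*(U0+U1+U2+U3) + p*r*s*(U0-U1-U2+U3)
      + p*q*s*(U0-U1+U2-U3) + p*q*r*(U0+U1-U2-U3))
    (h1 : p*q - r*s ≠ 0) (h2 : p*r-q*s ≠ 0) (h3 : p*s-q*r ≠ 0)
    (hα : α = (p^2-q^2-r^2+s^2)/(p*s-q*r)) (hβ : β = (p^2+q^2-r^2-s^2)/(p*q-r*s))
    (hγ : γ = (p^2-q^2+r^2-s^2)/(p*r-q*s))
    (hδ : δ = c*((p+q+r+s)*(p+q-r-s)*(p-q+r-s)*(p-q-r+s))/((p*q-r*s)*(p*r-q*s)*(p*s-q*r))) :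
    (P^2+Q^2+R^2+S^2 - α*(P*S+Q*R) - β*(P*Q+R*S) - γ*(P*R+Q*S))^2 - 4*δ^2*S*P*Q*R = 0 := by
  have e0 : P^2+Q^2+R^2+S^2 = 4*(a0*U0+a1*U1+a2*U2+a3*U3) := by subst_vars; ring
  have e1 : P*S+Q*R = 2*(a0*U0+a1*U1-a2*U2-a3*U3) := by subst_vars; ring
  have e2 : P*Q+R*S = 2*(a0*U0-a1*U1-a2*U2+a3*U3) := by subst_vars; ring
  have e3 : P*R+Q*S = 2*(a0*U0-a1*U1+a2*U2-a3*U3) := by subst_vars; ring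
  have hα' : α*(p*s-q*r) = (p^2-q^2-r^2+s^2) := by rw [hα]; field_simp
  have hβ' : β*(p*q-r*s) = (p^2+q^2-r^2-s^2) := by rw [hβ]; field_simp
  have hγ' : γ*(p*r-q*s) = (p^2-q^2+r^2-s^2) := by rw [hγ]; field_simp
  have hδ' : δ*((p*q-r*s)*(p*r-q*s)*(p*s-q*r)) = c*((p+q+r+s)*(p+q-r-s)*(p-q+r-s)*(p-q-r+s)) := by
    rw [hδ]; field_simp
  have hD : (p*q-r*s)*(p*r-q*s)*(p*s-q*r) ≠ 0 := mul_ne_zero (mul_ne_zero h1 h2) h3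
  have key : P^2+Q^2+R^2+S^2 - α*(P*S+Q*R) - β*(P*Q+R*S) - γ*(P*R+Q*S) = - (2*δ*W) := by
    rw [e0, e1, e2, e3]
    apply mul_right_cancel₀ hD
    have l : (4*(a0*U0+a1*U1+a2*U2+a3*U3) - α*(2*(a0*U0+a1*U1-a2*U2-a3*U3))
       - β*(2*(a0*U0-a1*U1-a2*U2+a3*U3)) - γ*(2*(a0*U0-a1*U1+a2*U2-a3*U3)))
        * ((p*q-r*s)*(p*r-q*s)*(p*s-q*r)) =
       4*(a0*U0+a1*U1+a2*U2+a3*U3)*((p*q-r*s)*(p*r-q*s)*(p*s-q*r))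
       - (p^2-q^2-r^2+s^2)*(2*(a0*U0+a1*U1-a2*U2-a3*U3))*((p*q-r*s)*(p*r-q*s))
       - (p^2+q^2-r^2-s^2)*(2*(a0*U0-a1*U1-a2*U2+a3*U3))*((p*r-q*s)*(p*s-q*r))
       - (p^2-q^2+r^2-s^2)*(2*(a0*U0-a1*U1+a2*U2-a3*U3))*((p*q-r*s)*(p*s-q*r)) := by
      rw [← hα', ← hβ', ← hγ']; ring
    have m : -(2*δ*W)*((p*q-r*s)*(p*r-q*s)*(p*s-q*r)) =
       -(1/2)*(4*(c*W))*((p+q+r+s)*(p+q-r-s)*(p-q+r-s)*(p-q-r+s)) := by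
      linear_combination (-2*W)*hδ'
    rw [l, m, hcW, hp, hq, hr, hs]
    clear * -
    ring
  rw [key]
  linear_combination (4*δ^2)*hW2

/-- For τ ∈ ℍ₂ with nondegenerate theta constants, the point
`[θ₁(z)² : θ₂(z)² : θ₃(z)² : θ₄(z)²]` lies on the Göpel quartic `Φ² - 4δ²SPQR = 0`
with moduli α, β, γ, δ given by theta constants. -/
theorem goepel_quartic_theta (τ : Matrix (Fin 2) (Fin 2) ℂ) (hτ : IsSiegel τ)
    (h1 : th 0 0 τ ^ 2 * th 1 0 τ ^ 2 - th 2 0 τ ^ 2 * th 3 0 τ ^ 2 ≠ 0)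
    (h2 : th 0 0 τ ^ 2 * th 2 0 τ ^ 2 - th 1 0 τ ^ 2 * th 3 0 τ ^ 2 ≠ 0)
    (h3 : th 0 0 τ ^ 2 * th 3 0 τ ^ 2 - th 1 0 τ ^ 2 * th 2 0 τ ^ 2 ≠ 0)
    (α β γ δ : ℂ)
    (hα : α = (th 0 0 τ ^ 4 - th 1 0 τ ^ 4 - th 2 0 τ ^ 4 + th 3 0 τ ^ 4) /
      (th 0 0 τ ^ 2 * th 3 0 τ ^ 2 - th 1 0 τ ^ 2 * th 2 0 τ ^ 2))
    (hβ : β = (th 0 0 τ ^ 4 + th 1 0 τ ^ 4 - th 2 0 τ ^ 4 - th 3 0 τ ^ 4) /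
      (th 0 0 τ ^ 2 * th 1 0 τ ^ 2 - th 2 0 τ ^ 2 * th 3 0 τ ^ 2))
    (hγ : γ = (th 0 0 τ ^ 4 - th 1 0 τ ^ 4 + th 2 0 τ ^ 4 - th 3 0 τ ^ 4) /
      (th 0 0 τ ^ 2 * th 2 0 τ ^ 2 - th 1 0 τ ^ 2 * th 3 0 τ ^ 2))
    (hδ : δ = th 0 0 τ * th 1 0 τ * th 2 0 τ * th 3 0 τ *
      ((th 0 0 τ ^ 2 + th 1 0 τ ^ 2 + th 2 0 τ ^ 2 + th 3 0 τ ^ 2) *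
       (th 0 0 τ ^ 2 + th 1 0 τ ^ 2 - th 2 0 τ ^ 2 - th 3 0 τ ^ 2) *
       (th 0 0 τ ^ 2 - th 1 0 τ ^ 2 + th 2 0 τ ^ 2 - th 3 0 τ ^ 2) *
       (th 0 0 τ ^ 2 - th 1 0 τ ^ 2 - th 2 0 τ ^ 2 + th 3 0 τ ^ 2)) /
      ((th 0 0 τ ^ 2 * th 1 0 τ ^ 2 - th 2 0 τ ^ 2 * th 3 0 τ ^ 2) *
       (th 0 0 τ ^ 2 * th 2 0 τ ^ 2 - th 1 0 τ ^ 2 * th 3 0 τ ^ 2) *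
       (th 0 0 τ ^ 2 * th 3 0 τ ^ 2 - th 1 0 τ ^ 2 * th 2 0 τ ^ 2))) :
    ∀ z : Fin 2 → ℂ,
      ((th 0 z τ ^ 2) ^ 2 + (th 1 z τ ^ 2) ^ 2 + (th 2 z τ ^ 2) ^ 2 + (th 3 z τ ^ 2) ^ 2
        - α * (th 0 z τ ^ 2 * th 3 z τ ^ 2 + th 1 z τ ^ 2 * th 2 z τ ^ 2)
        - β * (th 0 z τ ^ 2 * th 1 z τ ^ 2 + th 2 z τ ^ 2 * th 3 z τ ^ 2)
        - γ * (th 0 z τ ^ 2 * th 2 z τ ^ 2 + th 1 z τ ^ 2 * th 3 z τ ^ 2)) ^ 2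
      - 4 * δ ^ 2 * th 3 z τ ^ 2 * th 0 z τ ^ 2 * th 1 z τ ^ 2 * th 2 z τ ^ 2 = 0 := by
  intro z
  obtain ⟨hsym, hpos⟩ := hτ
  have H : SgPos (τ 0 0) (τ 0 1) (τ 1 1) := hpos
  have t0 : ∀ z, th 0 z τ = gth (τ 0 0) (τ 0 1) (τ 1 1) 0 0 (z 0) (z 1) := by
    intro z; rw [th, thetaFn_eq _ _ _ _ hsym]; simp [thetaChars]
  have t1 : ∀ z, th 1 z τ = gth (τ 0 0) (τ 0 1) (τ 1 1) 0 0 (z 0 + 1/2) (z 1 + 1/2) := by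
    intro z; rw [th, thetaFn_eq _ _ _ _ hsym]; simp [thetaChars]
  have t2 : ∀ z, th 2 z τ = gth (τ 0 0) (τ 0 1) (τ 1 1) 0 0 (z 0 + 1/2) (z 1) := by
    intro z; rw [th, thetaFn_eq _ _ _ _ hsym]; simp [thetaChars]
  have t3 : ∀ z, th 3 z τ = gth (τ 0 0) (τ 0 1) (τ 1 1) 0 0 (z 0) (z 1 + 1/2) := by
    intro z; rw [th, thetaFn_eq _ _ _ _ hsym]; simp [thetaChars]
  generalize τ 0 0 = p at *
  generalize τ 0 1 = q at *
  generalize τ 1 1 = r at *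
  have H2 := H.double
  have z0 : (0 : Fin 2 → ℂ) 0 = 0 := rfl
  have z1 : (0 : Fin 2 → ℂ) 1 = 0 := rfl
  -- products of the four theta functions
  have hc : th 0 0 τ * th 1 0 τ * th 2 0 τ * th 3 0 τ =
      gth (2*p) (2*q) (2*r) 0 0 (1/2) 0 ^ 2 * gth (2*p) (2*q) (2*r) 0 0 (1/2) 0 ^ 2
      - gth (2*p) (2*q) (2*r) 0 (1/2) (1/2) 0 ^ 2 * gth (2*p) (2*q) (2*r) 0 (1/2) (1/2) 0 ^ 2 := by
    have e1 := lev_prod₁₃ H 0 0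
    have e2 := lev_prod₂₄ H 0 0
    rw [t0, t1, t2, t3, z0, z1]
    simp only [mul_zero, zero_add] at e1 e2 ⊢
    rw [show ∀ a b c d : ℂ, a*b*c*d = (a*c)*(b*d) from fun _ _ _ _ => by ring, e1, e2]
    ring
  have hW : th 0 z τ * th 1 z τ * th 2 z τ * th 3 z τ =
      gth (2*p) (2*q) (2*r) 0 0 (2 * z 0 + 1/2) (2 * z 1) ^ 2
        * gth (2*p) (2*q) (2*r) 0 0 (1/2) 0 ^ 2
      - gth (2*p) (2*q) (2*r) 0 (1/2) (2 * z 0 + 1/2) (2 * z 1) ^ 2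
        * gth (2*p) (2*q) (2*r) 0 (1/2) (1/2) 0 ^ 2 := by
    have e1 := lev_prod₁₃ H (z 0) (z 1)
    have e2 := lev_prod₂₄ H (z 0) (z 1)
    rw [t0, t1, t2, t3]
    rw [show ∀ a b c d : ℂ, a*b*c*d = (a*c)*(b*d) from fun _ _ _ _ => by ring, e1, e2]
    ring
  -- squares of level 2 functions
  have a0 := lev_sq₁ H2 0 0
  have a1 := lev_sq_a₁ H2 0 0
  have a2 := lev_sq_a₂ H2 0 0
  have a3 := lev_sq_a₃ H2 0 0
  have v0 := lev_sq₃ H2 0 0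
  have v1 := lev_sq_V₁ H2 0 0
  simp only [mul_zero, zero_add] at a0 a1 a2 a3 v0 v1
  have U0 := lev_sq₁ H2 (2 * z 0) (2 * z 1)
  have U1 := lev_sq_a₁ H2 (2 * z 0) (2 * z 1)
  have U2 := lev_sq_a₂ H2 (2 * z 0) (2 * z 1)
  have U3 := lev_sq_a₃ H2 (2 * z 0) (2 * z 1)
  have V0 := lev_sq₃ H2 (2 * z 0) (2 * z 1)
  have V1 := lev_sq_V₁ H2 (2 * z 0) (2 * z 1)
  have key := alg_riemann
    (gth (2*(2*p)) (2*(2*q)) (2*(2*r)) 0 0 0 0)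
    (gth (2*(2*p)) (2*(2*q)) (2*(2*r)) (1/2) 0 0 0)
    (gth (2*(2*p)) (2*(2*q)) (2*(2*r)) 0 (1/2) 0 0)
    (gth (2*(2*p)) (2*(2*q)) (2*(2*r)) (1/2) (1/2) 0 0)
    (gth (2*(2*p)) (2*(2*q)) (2*(2*r)) 0 0 (2*(2 * z 0)) (2*(2 * z 1)))
    (gth (2*(2*p)) (2*(2*q)) (2*(2*r)) (1/2) 0 (2*(2 * z 0)) (2*(2 * z 1)))
    (gth (2*(2*p)) (2*(2*q)) (2*(2*r)) 0 (1/2) (2*(2 * z 0)) (2*(2 * z 1)))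
    (gth (2*(2*p)) (2*(2*q)) (2*(2*r)) (1/2) (1/2) (2*(2 * z 0)) (2*(2 * z 1)))
    _ _ _ _ _ _ _ _ _ _ _ _ _ _
    (U0.trans (by ring)) (U1.trans (by ring)) (U2.trans (by ring)) (U3.trans (by ring))
    (a0.trans (by ring)) (a1.trans (by ring)) (a2.trans (by ring)) (a3.trans (by ring))
    (V0.trans (by ring)) (V1.trans (by ring)) (v0.trans (by ring)) (v1.trans (by ring)) hc hW
  -- squares of level 1 functions
  have p1 := lev_sq₁ H 0 0
  have p2 := lev_sq₂ H 0 0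
  have p3 := lev_sq₃ H 0 0
  have p4 := lev_sq₄ H 0 0
  have P1 := lev_sq₁ H (z 0) (z 1)
  have P2 := lev_sq₂ H (z 0) (z 1)
  have P3 := lev_sq₃ H (z 0) (z 1)
  have P4 := lev_sq₄ H (z 0) (z 1)
  simp only [mul_zero] at p1 p2 p3 p4
  rw [← t0 z] at P1
  rw [← t1 z] at P2
  rw [← t2 z] at P3
  rw [← t3 z] at P4
  have q0 := t0 0
  have q1 := t1 0
  have q2 := t2 0
  have q3 := t3 0
  rw [z0, z1] at q0 q1 q2 q3
  rw [← q0] at p1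
  rw [← q1] at p2
  rw [← q2] at p3
  rw [← q3] at p4
  have p1' := p1.trans (by ring : _ = gth (2*p) (2*q) (2*r) 0 0 0 0 ^ 2
    + gth (2*p) (2*q) (2*r) (1/2) 0 0 0 ^ 2 + gth (2*p) (2*q) (2*r) 0 (1/2) 0 0 ^ 2
    + gth (2*p) (2*q) (2*r) (1/2) (1/2) 0 0 ^ 2)
  have p2' := p2.trans (by ring : _ = gth (2*p) (2*q) (2*r) 0 0 0 0 ^ 2
    - gth (2*p) (2*q) (2*r) (1/2) 0 0 0 ^ 2 - gth (2*p) (2*q) (2*r) 0 (1/2) 0 0 ^ 2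
    + gth (2*p) (2*q) (2*r) (1/2) (1/2) 0 0 ^ 2)
  have p3' := p3.trans (by ring : _ = gth (2*p) (2*q) (2*r) 0 0 0 0 ^ 2
    - gth (2*p) (2*q) (2*r) (1/2) 0 0 0 ^ 2 + gth (2*p) (2*q) (2*r) 0 (1/2) 0 0 ^ 2
    - gth (2*p) (2*q) (2*r) (1/2) (1/2) 0 0 ^ 2)
  have p4' := p4.trans (by ring : _ = gth (2*p) (2*q) (2*r) 0 0 0 0 ^ 2
    + gth (2*p) (2*q) (2*r) (1/2) 0 0 0 ^ 2 - gth (2*p) (2*q) (2*r) 0 (1/2) 0 0 ^ 2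
    - gth (2*p) (2*q) (2*r) (1/2) (1/2) 0 0 ^ 2)
  rw [← p1', ← p2', ← p3', ← p4'] at key
  exact alg_final _ _ _ _ _ _ _ _ _ _ _ _ _ _ _ _ _ _ _ _ _ _ _ _ _ _ α β γ δ
    rfl rfl rfl rfl rfl rfl rfl rfl p1' p2' p3' p4' P1 P2 P3 P4 (by ring) key h1 h2 h3
    (hα.trans (by ring)) (hβ.trans (by ring)) (hγ.trans (by ring)) hδ
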